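/- Low-Mach-number limit for the isentropic two-phase two-velocity system with algebraic pressure closure and interfacial pressure (order-by-order form of Proposition 4.1). Let d ≥ 1 and γ₊, γ₋ > 1. Let α₊⁰, α₋⁰, α₊¹, α₋¹, ρ₊⁰, ρ₋⁰, ρ₊¹, ρ₋¹, p_int⁰ : ℝ × ℝ^d → ℝ and u₊⁰, u₋⁰ : ℝ × ℝ^d → ℝ^d be smooth ℤ^d-periodic functions with ρ₊⁰ > 0, ρ₋⁰ > 0, 0 < α₊⁰ < 1 everywhere, satisfying: (i) α₊⁰ + α₋⁰ = 1; (ii) (ρ₊⁰)^{γ₊} = (ρ₋⁰)^{γ₋}; (iii) α₊⁰∇((ρ₊⁰)^{γ₊}) = 0 and α₋⁰∇((ρ₋⁰)^{γ₋}) = 0; (iv) γ₊(ρ₊⁰)^{γ₊−1}ρ₊¹ = γ₋(ρ₋⁰)^{γ₋−1}ρ₋¹; (v) ∂ₜ(α±⁰ρ±⁰) + div(α±⁰ρ±⁰u±⁰) = 0 for both phases; (vi) for each phase, ∂ₜ(α±⁰ρ±⁰u±⁰) + div(α±⁰ρ±⁰u±⁰⊗u±⁰) + α±⁰∇(γ±(ρ±⁰)^{γ±−1}ρ±¹)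 + α±¹∇((ρ±⁰)^{γ±}) + p_int⁰∇α±⁰ = 0. Then: ρ₊⁰ and ρ₋⁰ are constant in space and time; div(α₊⁰u₊⁰ + α₋⁰u₋⁰) = 0; ∂ₜα±⁰ + div(α±⁰u±⁰) = 0 for both phases; and, setting π := γ₊(ρ₊⁰)^{γ₊−1}ρ₊¹, the limit momentum equations ∂ₜ(α±⁰ρ±⁰u±⁰) + div(α±⁰ρ±⁰u±⁰⊗u±⁰) + α±⁰∇π + p_int⁰∇α±⁰ = 0 hold for both phases. -/

import Mathlib

open MeasureTheory Real

noncomputable section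

/-- A space–time point: time in `ℝ`, space in `ℝ^d`. -/
abbrev Pt (d : ℕ) := ℝ × (Fin d → ℝ)

/-- Time derivative `∂ₜ f`. -/
def pt {d : ℕ} (f : Pt d → ℝ) (p : Pt d) : ℝ :=
  fderiv ℝ f p (1, 0)

/-- Spatial partial derivative `∂_{x i} f`. -/
def pd {d : ℕ} (i : Fin d) (f : Pt d → ℝ) (p : Pt d) : ℝ :=
  fderiv ℝ f p (0, Pi.single i 1)

/-- Spatial divergence of a vector field. -/
def divg {d : ℕ} (u : Pt d → Fin d → ℝ) (p : Pt d) : ℝ :=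
  ∑ i, pd i (fun q => u q i) p

/-- Spatial Laplacian of a scalar function. -/
def lap {d : ℕ} (f : Pt d → ℝ) (p : Pt d) : ℝ :=
  ∑ i, pd i (fun q => pd i f q) p

/-- `i`-th component of `div (r u ⊗ u)`, i.e. `∑ j ∂_{x j} (r u_i u_j)`. -/
def divT {d : ℕ} (r : Pt d → ℝ) (u : Pt d → Fin d → ℝ) (p : Pt d) (i : Fin d) : ℝ :=
  ∑ j, pd j (fun q => r q * u q i * u q j) p

/-- Symmetric gradient `D(u) = (∇u + (∇u)ᵀ)/2`. -/
def Dsym {d : ℕ} (u : Pt d → Fin d → ℝ) (p : Pt d) (i j : Fin d) : ℝ :=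
  (pd j (fun q => u q i) p + pd i (fun q => u q j) p) / 2

/-- Divergence of a matrix field, `i`-th component `∑ j ∂_{x j} M_{ij}`. -/
def divM {d : ℕ} (M : Pt d → Fin d → Fin d → ℝ) (p : Pt d) (i : Fin d) : ℝ :=
  ∑ j, pd j (fun q => M q i j) p

/-- `ℤ^d`-periodicity in the space variable. -/
def ZPeriodic {d : ℕ} (f : Pt d → ℝ) : Prop :=
  ∀ (k : Fin d → ℤ) (t : ℝ) (x : Fin d → ℝ), f (t, x + fun i => (k i : ℝ)) = f (t, x)

/-- `ℤ^d`-periodicity of a vector field. -/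
def ZPeriodicVec {d : ℕ} (u : Pt d → Fin d → ℝ) : Prop :=
  ∀ i, ZPeriodic (fun q => u q i)

/-- The unit cell `[0,1]^d`. -/
def cell (d : ℕ) : Set (Fin d → ℝ) := Set.Icc 0 1

section Calculus

variable {d : ℕ}

theorem pt_mul {f g : Pt d → ℝ} (hf : Differentiable ℝ f) (hg : Differentiable ℝ g) (p : Pt d) :
    pt (fun q => f q * g q) p = f p * pt g p + g p * pt f p := by
  simp [pt, fderiv_fun_mul (hf p) (hg p)]

theorem pd_mul {f g : Pt d → ℝ} (hf : Differentiable ℝ f) (hg : Differentiable ℝ g) (i : Fin d)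
    (p : Pt d) : pd i (fun q => f q * g q) p = f p * pd i g p + g p * pd i f p := by
  simp [pd, fderiv_fun_mul (hf p) (hg p)]

theorem pt_rpow {f : Pt d → ℝ} (hf : Differentiable ℝ f) {γ : ℝ} {p : Pt d} (hp : 0 < f p) :
    pt (fun q => f q ^ γ) p = γ * f p ^ (γ - 1) * pt f p := by
  simp [pt, ((hf p).hasFDerivAt.rpow_const (p := γ) (Or.inl hp.ne')).fderiv]

theorem pd_rpow {f : Pt d → ℝ} (hf : Differentiable ℝ f) {γ : ℝ} {p : Pt d} (hp : 0 < f p)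
    (i : Fin d) : pd i (fun q => f q ^ γ) p = γ * f p ^ (γ - 1) * pd i f p := by
  simp [pd, ((hf p).hasFDerivAt.rpow_const (p := γ) (Or.inl hp.ne')).fderiv]

theorem pd_eq_zero_of_pd_rpow_eq_zero {f : Pt d → ℝ} (hf : Differentiable ℝ f) {γ : ℝ}
    (hγ : 0 < γ) {p : Pt d} (hp : 0 < f p) {i : Fin d}
    (h : pd i (fun q => f q ^ γ) p = 0) : pd i f p = 0 := by
  rw [pd_rpow hf hp] at h
  exact (mul_eq_zero.1 h).resolve_left (mul_pos hγ (rpow_pos_of_pos hp _)).ne'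

theorem pt_eq_zero_of_pt_rpow_eq_zero {f : Pt d → ℝ} (hf : Differentiable ℝ f) {γ : ℝ}
    (hγ : 0 < γ) {p : Pt d} (hp : 0 < f p)
    (h : pt (fun q => f q ^ γ) p = 0) : pt f p = 0 := by
  rw [pt_rpow hf hp] at h
  exact (mul_eq_zero.1 h).resolve_left (mul_pos hγ (rpow_pos_of_pos hp _)).ne'

theorem divg_add {u v : Pt d → Fin d → ℝ} (hu : Differentiable ℝ u) (hv : Differentiable ℝ v)
    (p : Pt d) : divg (fun q j => u q j + v q j) p = divg u p + divg v p := by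
  simp only [divg, ← Finset.sum_add_distrib]
  refine Finset.sum_congr rfl fun i _ => ?_
  simp [pd, fderiv_fun_add (differentiable_pi.1 hu i p) (differentiable_pi.1 hv i p)]

theorem divg_mul {f : Pt d → ℝ} {u : Pt d → Fin d → ℝ} (hf : Differentiable ℝ f)
    (hu : Differentiable ℝ u) (p : Pt d) :
    divg (fun q j => f q * u q j) p = f p * divg u p + ∑ i, u p i * pd i f p := by
  simp only [divg, Finset.mul_sum, ← Finset.sum_add_distrib]
  exact Finset.sum_congr rfl fun i _ => pd_mul hf (differentiable_pi.1 hu i) i p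

/-- If all spatial partial derivatives vanish, so does the derivative in every spatial direction. -/
theorem fderiv_space_eq_zero {f : Pt d → ℝ} {p : Pt d} (h : ∀ i, pd i f p = 0)
    (v : Fin d → ℝ) : fderiv ℝ f p (0, v) = 0 := by
  have hL : (fderiv ℝ f p ∘L ContinuousLinearMap.inr ℝ ℝ (Fin d → ℝ)).toLinearMap = 0 := by
    refine LinearMap.pi_ext' fun i => LinearMap.ext_ring ?_
    simpa [pd] using h i
  simpa using LinearMap.congr_fun hL v

theorem eq_of_pd_eq_zero {f : Pt d → ℝ} (hf : Differentiable ℝ f) (h : ∀ p i, pd i f p = 0)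
    (t : ℝ) (x y : Fin d → ℝ) : f (t, x) = f (t, y) := by
  have hd : ∀ x, HasFDerivAt (fun x => f (t, x))
      (fderiv ℝ f (t, x) ∘L ContinuousLinearMap.inr ℝ ℝ (Fin d → ℝ)) x := fun x =>
    (hf (t, x)).hasFDerivAt.comp x (hasFDerivAt_prodMk_right t x)
  refine is_const_of_fderiv_eq_zero (𝕜 := ℝ) (fun x => (hd x).differentiableAt) (fun x => ?_) x y
  rw [(hd x).fderiv]
  ext v
  simpa using fderiv_space_eq_zero (h (t, x)) v

theorem pt_eq_of_pd_eq_zero {f : Pt d → ℝ} (hf : Differentiable ℝ f) (h : ∀ p i, pd i f p = 0)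
    (t : ℝ) (x y : Fin d → ℝ) : pt f (t, x) = pt f (t, y) := by
  have hshift : (fun q : Pt d => f (q + (0, y - x))) = f := by
    funext q
    simpa [Prod.add_def] using eq_of_pd_eq_zero hf h q.1 (q.2 + (y - x)) q.2
  have := fderiv_comp_add_right (𝕜 := ℝ) (f := f) (x := (t, x)) (0, y - x)
  rw [hshift] at this
  simp [pt, this]

theorem eq_of_pt_eq_zero_of_pd_eq_zero {f : Pt d → ℝ} (hf : Differentiable ℝ f)
    (ht : ∀ p, pt f p = 0) (hx : ∀ p i, pd i f p = 0) (p q : Pt d) : f p = f q := by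
  refine is_const_of_fderiv_eq_zero (𝕜 := ℝ) hf (fun p => ?_) p q
  ext v
  · simpa [pt] using ht p
  · simpa using fderiv_space_eq_zero (hx p) _

theorem continuous_divg {u : Pt d → Fin d → ℝ} (hu : ContDiff ℝ 1 u) : Continuous (divg u) :=
  continuous_finsetSum _ fun i _ =>
    ((contDiff_pi.1 hu i).continuous_fderiv one_ne_zero).clm_apply continuous_const

end Calculus

/-- The divergence of a periodic vector field has zero mean over the unit cell. -/
theorem integral_divg_eq_zero {d : ℕ} (hd : 1 ≤ d) {u : Pt d → Fin d → ℝ} (hu : ContDiff ℝ 1 u)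
    (hper : ZPeriodicVec u) (t : ℝ) : ∫ x in cell d, divg u (t, x) = 0 := by
  obtain ⟨n, rfl⟩ : ∃ n, d = n + 1 := ⟨d - 1, by omega⟩
  have hdiff : ∀ i, Differentiable ℝ fun q => u q i :=
    differentiable_pi.1 (hu.differentiable one_ne_zero)
  have hcont : Continuous fun x => divg u (t, x) := (continuous_divg hu).comp (by fun_prop)
  have key := integral_divergence_of_hasFDerivAt_off_countable' (0 : Fin (n + 1) → ℝ) 1
    zero_le_one (fun i x => u (t, x) i)
    (fun i x => fderiv ℝ (fun q => u q i) (t, x) ∘L ContinuousLinearMap.inr ℝ ℝ _)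
    ∅ Set.countable_empty
    (fun i => ((hdiff i).continuous.comp (by fun_prop : Continuous fun x => (t, x))).continuousOn)
    (fun x _ i => (hdiff i (t, x)).hasFDerivAt.comp x (hasFDerivAt_prodMk_right t x))
    (by simpa [divg, pd] using hcont.continuousOn.integrableOn_compact isCompact_Icc)
  have hface : ∀ (i : Fin (n + 1)) (x : Fin n → ℝ),
      u (t, i.insertNth 1 x) i = u (t, i.insertNth 0 x) i := by
    intro i x
    refine Eq.trans ?_ (hper i (Pi.single i 1) t (i.insertNth 0 x))
    refine congrArg (fun y => u (t, y) i) ?_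
    funext j
    refine Fin.succAboveCases i ?_ (fun k => ?_) j <;> simp
  simpa [divg, pd, cell, hface] using key

/-- If a constant times a continuous positive function has zero integral over the unit cell,
then the constant vanishes. -/
theorem eq_zero_of_integral_cell_mul_eq_zero {d : ℕ} {k : (Fin d → ℝ) → ℝ} {c L : ℝ}
    (hk : Continuous k) (hc : 0 < c) (hck : ∀ x, c ≤ k x)
    (h : ∫ x in cell d, L * k x = 0) : L = 0 := by
  rw [integral_const_mul] at h
  refine (mul_eq_zero.1 h).resolve_right (ne_of_gt ?_)
  have hvol : volume.real (cell d) = 1 := by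
    simp [cell, Measure.real, Real.volume_Icc_pi]
  calc 0 < c := hc
    _ = ∫ _ in cell d, c := by simp [hvol]
    _ ≤ ∫ x in cell d, k x :=
      setIntegral_mono (continuous_const.continuousOn.integrableOn_compact isCompact_Icc)
        (hk.continuousOn.integrableOn_compact isCompact_Icc) hck

/-- The volume-fraction equation of a phase whose density is homogeneous in space. -/
theorem pt_add_divg_eq_of_mass {d : ℕ} {α ρ : Pt d → ℝ} {u : Pt d → Fin d → ℝ} {γ : ℝ}
    (hα : Differentiable ℝ α) (hρ : Differentiable ℝ ρ) (hu : Differentiable ℝ u) (hγ : 0 < γ)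
    {p : Pt d} (hpos : 0 < ρ p) (hx : ∀ i, pd i ρ p = 0)
    (hmass : pt (fun q => α q * ρ q) p + divg (fun q j => α q * ρ q * u q j) p = 0) :
    pt α p + divg (fun q j => α q * u q j) p
      = -(pt (fun q => ρ q ^ γ) p / ρ p ^ γ * (α p / γ)) := by
  have hαu : Differentiable ℝ fun q j => α q * u q j :=
    differentiable_pi.2 fun j => hα.mul (differentiable_pi.1 hu j)
  have hcomm : (fun q j => α q * ρ q * u q j) = fun q j => ρ q * (α q * u q j) := by
    funext q j
    ring
  rw [pt_mul hα hρ, hcomm, divg_mul hρ hαu] at hmass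
  simp only [hx, mul_zero, Finset.sum_const_zero, add_zero] at hmass
  have hP : pt (fun q => ρ q ^ γ) p / ρ p ^ γ * (α p / γ) = α p * pt ρ p / ρ p := by
    rw [pt_rpow hρ hpos, rpow_sub_one hpos.ne']
    have := (rpow_pos_of_pos hpos γ).ne'
    field_simp
  rw [hP, eq_neg_iff_add_eq_zero, ← mul_right_inj' hpos.ne']
  field_simp
  linarith

/-- low-Mach-number limit for the isentropic two-phase two-velocity
system with algebraic pressure closure and interfacial pressure
(order-by-order form of Proposition 4.1). -/
theorem lowMach_twoPhase_twoVelocity_algebraic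
    {d : ℕ} (hd : 1 ≤ d) (γp γm : ℝ) (hγp : 1 < γp) (hγm : 1 < γm)
    (αp0 αm0 αp1 αm1 ρp0 ρm0 ρp1 ρm1 pint0 : Pt d → ℝ)
    (up0 um0 : Pt d → Fin d → ℝ)
    (hreg : ContDiff ℝ (⊤ : ℕ∞) αp0 ∧ ContDiff ℝ (⊤ : ℕ∞) αm0 ∧ ContDiff ℝ (⊤ : ℕ∞) αp1 ∧ ContDiff ℝ (⊤ : ℕ∞) αm1 ∧
      ContDiff ℝ (⊤ : ℕ∞) ρp0 ∧ ContDiff ℝ (⊤ : ℕ∞) ρm0 ∧ ContDiff ℝ (⊤ : ℕ∞) ρp1 ∧ ContDiff ℝ (⊤ : ℕ∞) ρm1 ∧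
      ContDiff ℝ (⊤ : ℕ∞) pint0 ∧ ContDiff ℝ (⊤ : ℕ∞) up0 ∧ ContDiff ℝ (⊤ : ℕ∞) um0)
    (hper : ZPeriodic αp0 ∧ ZPeriodic αm0 ∧ ZPeriodic αp1 ∧ ZPeriodic αm1 ∧
      ZPeriodic ρp0 ∧ ZPeriodic ρm0 ∧ ZPeriodic ρp1 ∧ ZPeriodic ρm1 ∧
      ZPeriodic pint0 ∧ ZPeriodicVec up0 ∧ ZPeriodicVec um0)
    (hρp : ∀ p, 0 < ρp0 p) (hρm : ∀ p, 0 < ρm0 p)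
    (hαpos : ∀ p, 0 < αp0 p ∧ αp0 p < 1)
    -- (i)
    (hα0 : ∀ p, αp0 p + αm0 p = 1)
    -- (ii)
    (hpeq0 : ∀ p, ρp0 p ^ γp = ρm0 p ^ γm)
    -- (iii)
    (hgradp : ∀ p (i : Fin d), αp0 p * pd i (fun q => ρp0 q ^ γp) p = 0)
    (hgradm : ∀ p (i : Fin d), αm0 p * pd i (fun q => ρm0 q ^ γm) p = 0)
    -- (iv)
    (hpeq1 : ∀ p, γp * ρp0 p ^ (γp - 1) * ρp1 p = γm * ρm0 p ^ (γm - 1) * ρm1 p)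
    -- (v)
    (hmassp : ∀ p, pt (fun q => αp0 q * ρp0 q) p
      + divg (fun q j => αp0 q * ρp0 q * up0 q j) p = 0)
    (hmassm : ∀ p, pt (fun q => αm0 q * ρm0 q) p
      + divg (fun q j => αm0 q * ρm0 q * um0 q j) p = 0)
    -- (vi)
    (hmomp : ∀ p (i : Fin d),
      pt (fun q => αp0 q * ρp0 q * up0 q i) p
      + divT (fun q => αp0 q * ρp0 q) up0 p i
      + αp0 p * pd i (fun q => γp * ρp0 q ^ (γp - 1) * ρp1 q) p
      + αp1 p * pd i (fun q => ρp0 q ^ γp) p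
      + pint0 p * pd i αp0 p = 0)
    (hmomm : ∀ p (i : Fin d),
      pt (fun q => αm0 q * ρm0 q * um0 q i) p
      + divT (fun q => αm0 q * ρm0 q) um0 p i
      + αm0 p * pd i (fun q => γm * ρm0 q ^ (γm - 1) * ρm1 q) p
      + αm1 p * pd i (fun q => ρm0 q ^ γm) p
      + pint0 p * pd i αm0 p = 0) :
    -- conclusions
    (∀ p q : Pt d, ρp0 p = ρp0 q) ∧ (∀ p q : Pt d, ρm0 p = ρm0 q) ∧
    (∀ p : Pt d, divg (fun q j => αp0 q * up0 q j + αm0 q * um0 q j) p = 0) ∧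
    (∀ p : Pt d, pt αp0 p + divg (fun q j => αp0 q * up0 q j) p = 0) ∧
    (∀ p : Pt d, pt αm0 p + divg (fun q j => αm0 q * um0 q j) p = 0) ∧
    (∀ p (i : Fin d),
      pt (fun q => αp0 q * ρp0 q * up0 q i) p
      + divT (fun q => αp0 q * ρp0 q) up0 p i
      + αp0 p * pd i (fun q => γp * ρp0 q ^ (γp - 1) * ρp1 q) p
      + pint0 p * pd i αp0 p = 0) ∧
    (∀ p (i : Fin d),
      pt (fun q => αm0 q * ρm0 q * um0 q i) p
      + divT (fun q => αm0 q * ρm0 q) um0 p i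
      + αm0 p * pd i (fun q => γp * ρp0 q ^ (γp - 1) * ρp1 q) p
      + pint0 p * pd i αm0 p = 0) := by
  obtain ⟨hαp, hαm, -, -, hρp', hρm', -, -, -, hup, hum⟩ := hreg
  obtain ⟨perαp, perαm, -, -, -, -, -, -, -, perup, perum⟩ := hper
  have hγp0 : 0 < γp := one_pos.trans hγp
  have hγm0 : 0 < γm := one_pos.trans hγm
  have dαp : Differentiable ℝ αp0 := hαp.differentiable (by simp)
  have dαm : Differentiable ℝ αm0 := hαm.differentiable (by simp)
  have dρp : Differentiable ℝ ρp0 := hρp'.differentiable (by simp)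
  have dρm : Differentiable ℝ ρm0 := hρm'.differentiable (by simp)
  have dup : Differentiable ℝ up0 := hup.differentiable (by simp)
  have dum : Differentiable ℝ um0 := hum.differentiable (by simp)
  have hαmpos : ∀ p, 0 < αm0 p := fun p => by linarith [hα0 p, (hαpos p).2]
  have gradPp : ∀ p i, pd i (fun q => ρp0 q ^ γp) p = 0 := fun p i =>
    (mul_eq_zero.1 (hgradp p i)).resolve_left (hαpos p).1.ne'
  have gradPm : ∀ p i, pd i (fun q => ρm0 q ^ γm) p = 0 := fun p i =>
    (mul_eq_zero.1 (hgradm p i)).resolve_left (hαmpos p).ne'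
  have gradρp : ∀ p i, pd i ρp0 p = 0 := fun p i =>
    pd_eq_zero_of_pd_rpow_eq_zero dρp hγp0 (hρp p) (gradPp p i)
  have gradρm : ∀ p i, pd i ρm0 p = 0 := fun p i =>
    pd_eq_zero_of_pd_rpow_eq_zero dρm hγm0 (hρm p) (gradPm p i)
  have hPeq : (fun q => ρm0 q ^ γm) = fun q => ρp0 q ^ γp := funext fun q => (hpeq0 q).symm
  have dP : Differentiable ℝ fun q => ρp0 q ^ γp := fun p =>
    ((dρp p).hasFDerivAt.rpow_const (Or.inl (hρp p).ne')).differentiableAt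
  have fracp := fun p => pt_add_divg_eq_of_mass dαp dρp dup hγp0 (hρp p) (gradρp p) (hmassp p)
  have fracm := fun p => pt_add_divg_eq_of_mass dαm dρm dum hγm0 (hρm p) (gradρm p) (hmassm p)
  simp only [← hpeq0] at fracm
  have hsum : ∀ p, pt αp0 p + pt αm0 p = 0 := fun p => by
    have h1 : (fun q => αp0 q + αm0 q) = fun _ => (1 : ℝ) := funext hα0
    have h2 : fderiv ℝ (fun q => αp0 q + αm0 q) p (1, 0) = 0 := by simp [h1]
    rwa [fderiv_fun_add (dαp p) (dαm p)] at h2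
  have hαup : ContDiff ℝ 1 fun q j => αp0 q * up0 q j :=
    (contDiff_pi.2 fun j => hαp.mul (contDiff_pi.1 hup j)).of_le (by exact_mod_cast le_top)
  have hαum : ContDiff ℝ 1 fun q j => αm0 q * um0 q j :=
    (contDiff_pi.2 fun j => hαm.mul (contDiff_pi.1 hum j)).of_le (by exact_mod_cast le_top)
  have hdiv : ∀ p, divg (fun q j => αp0 q * up0 q j + αm0 q * um0 q j) p
      = -(pt (fun q => ρp0 q ^ γp) p / ρp0 p ^ γp) * (αp0 p / γp + αm0 p / γm) := fun p => by
    rw [divg_add (hαup.differentiable one_ne_zero) (hαum.differentiable one_ne_zero)]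
    linarith [fracp p, fracm p, hsum p]
  have hper : ZPeriodicVec fun q j => αp0 q * up0 q j + αm0 q * um0 q j := fun i k t x => by
    simp only [perαp k t x, perαm k t x, perup i k t x, perum i k t x]
  have ptP : ∀ p, pt (fun q => ρp0 q ^ γp) p = 0 := by
    rintro ⟨t, y⟩
    have hint := integral_divg_eq_zero hd (hαup.add hαum) hper t
    simp only [Pi.add_def, hdiv, pt_eq_of_pd_eq_zero dP gradPp t _ y,
      eq_of_pd_eq_zero dP gradPp t _ y] at hint
    have hL := eq_zero_of_integral_cell_mul_eq_zero (c := min (1 / γp) (1 / γm))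
      (by have := hαp.continuous; have := hαm.continuous; fun_prop)
      (lt_min (by positivity) (by positivity)) (fun x => ?_) hint
    · rw [neg_eq_zero, div_eq_zero_iff] at hL
      exact hL.resolve_right (rpow_pos_of_pos (hρp _) _).ne'
    · have h1 := mul_le_mul_of_nonneg_left (min_le_left (1 / γp) (1 / γm)) (hαpos (t, x)).1.le
      have h2 := mul_le_mul_of_nonneg_left (min_le_right (1 / γp) (1 / γm)) (hαmpos (t, x)).le
      calc min (1 / γp) (1 / γm)
          = (αp0 (t, x) + αm0 (t, x)) * min (1 / γp) (1 / γm) := by rw [hα0, one_mul]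
        _ ≤ αp0 (t, x) * (1 / γp) + αm0 (t, x) * (1 / γm) := by linarith
        _ = αp0 (t, x) / γp + αm0 (t, x) / γm := by ring
  have hpi : (fun q => γm * ρm0 q ^ (γm - 1) * ρm1 q)
      = fun q => γp * ρp0 q ^ (γp - 1) * ρp1 q := funext fun q => (hpeq1 q).symm
  refine ⟨eq_of_pt_eq_zero_of_pd_eq_zero dρp
      (fun p => pt_eq_zero_of_pt_rpow_eq_zero dρp hγp0 (hρp p) (ptP p)) gradρp,
    eq_of_pt_eq_zero_of_pd_eq_zero dρm
      (fun p => pt_eq_zero_of_pt_rpow_eq_zero dρm hγm0 (hρm p) (hPeq ▸ ptP p)) gradρm,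
    fun p => by simp [hdiv, ptP], fun p => by simp [fracp, ptP], fun p => by simp [fracm, ptP],
    fun p i => ?_, fun p i => ?_⟩
  · simpa [gradPp] using hmomp p i
  · simpa [gradPm, hpi] using hmomm p i
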